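/- Let ζ ∈ S_∞. Define a sequence ζ = ζ_0, ζ_1, ζ_2, … by the rule: if ζ_j ≠ e, let α be minimal subject to α < ζ_j(α), let β be maximal subject to ζ_j(β) < ζ_j(α) ≤ β, and set ζ_{j+1} := ζ_j(α,β). Then this iteration reaches the identity e after finitely many steps, say ζ_m = e; and for every u ∈ S_∞ and k ∈ ℕ with u ≤_k ζu, the sequence u = ζ_m u ⋖_k ζ_{m−1} u ⋖_k ⋯ ⋖_k ζ_1 u ⋖_k ζ_0 u = ζu is a saturated chain in the k-Bruhat order from u to ζu; in particular m = ℓ(ζu) − ℓ(u). -/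

import Mathlib

/-- A permutation of the positive integers belongs to `S_∞` when it moves only
finitely many points. -/
def FinSupp (w : Equiv.Perm ℕ+) : Prop := {x : ℕ+ | w x ≠ x}.Finite

/-- The length `ℓ(w)` of a permutation: its number of inversions, i.e. of pairs
`i < j` with `w i > w j`. -/
noncomputable def len (w : Equiv.Perm ℕ+) : ℕ :=
  Set.ncard {p : ℕ+ × ℕ+ | p.1 < p.2 ∧ w p.2 < w p.1}

/-- Covering relation of the `k`-Bruhat order: `u ⋖_k u(a,b)` for `a ≤ k < b`
with `ℓ(u(a,b)) = ℓ(u) + 1`.  Here `u(a,b) = u * (swap a b)`. -/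
def kBruhatCov (k : ℕ+) (u w : Equiv.Perm ℕ+) : Prop :=
  ∃ a b : ℕ+, a ≤ k ∧ k < b ∧ w = u * Equiv.swap a b ∧ len w = len u + 1

/-- The `k`-Bruhat order `u ≤_k w`: a chain of `k`-Bruhat covers from `u` to `w`
(or `u = w`). -/
def kBruhat (k : ℕ+) : Equiv.Perm ℕ+ → Equiv.Perm ℕ+ → Prop :=
  Relation.ReflTransGen (kBruhatCov k)
/-- One step of the algorithm: if `ζ ≠ e`, choose `α` minimal with `α < ζ(α)`,
choose `β` maximal with `ζ(β) < ζ(α) ≤ β`, and pass to `ζ(α,β) = ζ * swap α β`. -/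
def AlgStep (ζ ζ' : Equiv.Perm ℕ+) : Prop :=
  ζ ≠ 1 ∧ ∃ α β : ℕ+,
    (α < ζ α ∧ ∀ α' : ℕ+, α' < ζ α' → α ≤ α') ∧
    ((ζ β < ζ α ∧ ζ α ≤ β) ∧ ∀ β' : ℕ+, ζ β' < ζ α → ζ α ≤ β' → β' ≤ β) ∧
    ζ' = ζ * Equiv.swap α β

open Equiv

theorem FinSupp.mul {u v : Perm ℕ+} (hu : FinSupp u) (hv : FinSupp v) : FinSupp (u * v) := by
  refine (Set.Finite.union hu hv).subset fun x hx => ?_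
  by_contra h
  simp only [Set.mem_union, Set.mem_ofPred_eq, not_or, not_not] at h
  exact hx (by rw [Perm.mul_apply, h.2, h.1])

theorem finSupp_swap (a b : ℕ+) : FinSupp (swap a b) := by
  refine (Set.toFinite {a, b}).subset fun x hx => ?_
  by_contra h
  simp only [Set.mem_insert_iff, Set.mem_singleton_iff, not_or] at h
  exact hx (swap_apply_of_ne_of_ne h.1 h.2)

/-- The set of inversions of a permutation. -/
def inversions (w : Perm ℕ+) : Set (ℕ+ × ℕ+) := {p | p.1 < p.2 ∧ w p.2 < w p.1}

theorem FinSupp.finite_inversions {w : Perm ℕ+} (hw : FinSupp w) : (inversions w).Finite := by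
  obtain ⟨N, hN⟩ := hw.bddAbove
  have hfix : ∀ x, N < x → w x = x := fun x hx => by
    by_contra h
    exact absurd (hN h) (not_le.mpr hx)
  have hle : ∀ x, x ≤ N → w x ≤ N := fun x hx => by
    by_contra! h
    have := w.injective (hfix _ h)
    exact absurd hx (not_le.mpr (this ▸ h))
  refine ((Set.finite_Iic N).prod (Set.finite_Iic N)).subset ?_
  rintro ⟨i, j⟩ ⟨hij, hw'⟩
  dsimp only at hij hw'
  have hj : j ≤ N := by
    by_contra! h
    rw [hfix j h] at hw'
    rcases le_or_gt i N with hi | hi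
    · exact absurd (hw'.trans_le (hle i hi)) (not_lt.mpr h.le)
    · rw [hfix i hi] at hw'
      exact absurd hij (not_lt.mpr hw'.le)
  exact ⟨hij.le.trans hj, hj⟩

/-- Apply the transposition `(a,b)` to both entries of a pair whenever this keeps them in
increasing order. -/
def swapPair (a b : ℕ+) (p : ℕ+ × ℕ+) : ℕ+ × ℕ+ :=
  if swap a b p.1 < swap a b p.2 then (swap a b p.1, swap a b p.2) else p

theorem swapPair_swapPair {a b : ℕ+} {p : ℕ+ × ℕ+} (hp : p.1 < p.2) :
    swapPair a b (swapPair a b p) = p := by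
  unfold swapPair
  split_ifs <;> simp_all

theorem swap_lt_swap_or {a b i j : ℕ+} (hab : a < b) (hij : i < j) :
    swap a b i < swap a b j ∨ (i = a ∧ j = b) ∨ (i = a ∧ j < b) ∨ (a < i ∧ j = b) := by
  simp only [swap_apply_def]
  split_ifs <;> grind

theorem swapPair_mapsTo {w : Perm ℕ+} {a b : ℕ+} (hab : a < b) (hw : w a < w b) :
    Set.MapsTo (swapPair a b) (inversions w) (inversions (w * swap a b) \ {(a, b)}) := by
  rintro ⟨i, j⟩ ⟨hij, hinv⟩
  dsimp only at hij hinv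
  unfold swapPair
  dsimp only
  split_ifs with h
  · refine ⟨⟨h, by simpa using hinv⟩, fun he => ?_⟩
    simp only [Set.mem_singleton_iff, Prod.mk.injEq] at he
    have hi : i = b := (Equiv.swap_apply_eq_iff.mp he.1).trans (swap_apply_left a b)
    have hj : j = a := (Equiv.swap_apply_eq_iff.mp he.2).trans (swap_apply_right a b)
    subst hi hj
    exact absurd hij (not_lt.mpr hab.le)
  · rcases (swap_lt_swap_or hab hij).resolve_left h with ⟨rfl, rfl⟩ | ⟨rfl, hj⟩ | ⟨hi, rfl⟩
    · exact absurd hinv (not_lt.mpr hw.le)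
    · refine ⟨⟨hij, ?_⟩, by simp [hj.ne]⟩
      simp only [Perm.mul_apply, swap_apply_left, swap_apply_of_ne_of_ne hij.ne' hj.ne]
      exact hinv.trans hw
    · refine ⟨⟨hij, ?_⟩, by simp [hi.ne']⟩
      simp only [Perm.mul_apply, swap_apply_right, swap_apply_of_ne_of_ne hi.ne' hij.ne]
      exact hw.trans hinv

theorem swapPair_injOn (w : Perm ℕ+) (a b : ℕ+) : Set.InjOn (swapPair a b) (inversions w) :=
  fun p hp q hq h => by rw [← swapPair_swapPair (a := a) (b := b) hp.1, h, swapPair_swapPair hq.1]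

theorem mem_inversions_mul_swap {w : Perm ℕ+} {a b : ℕ+} (hab : a < b) (hw : w a < w b) :
    (a, b) ∈ inversions (w * swap a b) := ⟨hab, by simpa using hw⟩

theorem ncard_inversions_diff {w : Perm ℕ+} {a b : ℕ+} (hf : FinSupp w) (hab : a < b)
    (hw : w a < w b) :
    (inversions (w * swap a b) \ {(a, b)}).ncard + 1 = len (w * swap a b) :=
  Set.ncard_sdiff_singleton_add_one (mem_inversions_mul_swap hab hw)
    (hf.mul (finSupp_swap a b)).finite_inversions

theorem len_lt_len_mul_swap {w : Perm ℕ+} {a b : ℕ+} (hf : FinSupp w) (hab : a < b)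
    (hw : w a < w b) : len w < len (w * swap a b) := by
  rw [← ncard_inversions_diff hf hab hw, Nat.lt_succ_iff]
  exact Set.ncard_le_ncard_of_injOn _ (swapPair_mapsTo hab hw) (swapPair_injOn w a b)
    ((hf.mul (finSupp_swap a b)).finite_inversions.sdiff)

theorem len_mul_swap_lt_len {w : Perm ℕ+} {a b : ℕ+} (hf : FinSupp w) (hab : a < b)
    (hw : w b < w a) : len (w * swap a b) < len w := by
  simpa [mul_assoc] using len_lt_len_mul_swap (w := w * swap a b) (hf.mul (finSupp_swap a b)) hab
    (by simpa using hw)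

theorem len_mul_swap_eq_add_one {w : Perm ℕ+} {a b : ℕ+} (hf : FinSupp w) (hab : a < b)
    (hw : w a < w b) (hc : ∀ c, a < c → c < b → w a < w c → ¬ w c < w b) :
    len (w * swap a b) = len w + 1 := by
  rw [← ncard_inversions_diff hf hab hw, Nat.add_right_cancel_iff]
  refine (Set.ncard_congr (fun p _ => swapPair a b p) (swapPair_mapsTo hab hw)
    (fun p q hp hq h => swapPair_injOn w a b hp hq h) ?_).symm
  rintro ⟨i, j⟩ ⟨⟨hij, hinv⟩, hne⟩
  dsimp only at hij hinv
  refine ⟨swapPair a b (i, j), ?_, swapPair_swapPair hij⟩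
  unfold swapPair
  dsimp only
  split_ifs with h
  · exact ⟨h, hinv⟩
  · rcases (swap_lt_swap_or hab hij).resolve_left h with ⟨rfl, rfl⟩ | ⟨rfl, hj⟩ | ⟨hi, rfl⟩
    · simp at hne
    · simp only [Perm.mul_apply, swap_apply_left, swap_apply_of_ne_of_ne hij.ne' hj.ne] at hinv
      refine ⟨hij, lt_of_le_of_ne (not_lt.mp fun h' => hc j hij hj h' hinv) ?_⟩
      exact fun he => hij.ne' (w.injective he)
    · simp only [Perm.mul_apply, swap_apply_right, swap_apply_of_ne_of_ne hi.ne' hij.ne] at hinv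
      refine ⟨hij, lt_of_le_of_ne (not_lt.mp fun h' => hc i hi hij hinv h') ?_⟩
      exact fun he => hij.ne' (w.injective he)

theorem lt_and_not_between_of_len_mul_swap {w : Perm ℕ+} {a b : ℕ+} (hf : FinSupp w) (hab : a < b)
    (hl : len (w * swap a b) = len w + 1) :
    w a < w b ∧ ∀ c, a < c → c < b → w a < w c → ¬ w c < w b := by
  have hw : w a < w b := by
    rcases lt_trichotomy (w a) (w b) with h | h | h
    · exact h
    · exact absurd (w.injective h) hab.ne
    · have := len_mul_swap_lt_len hf hab h
      omega
  refine ⟨hw, fun c hac hcb h1 h2 => ?_⟩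
  have hmem : (a, c) ∈ inversions (w * swap a b) \ {(a, b)} := by
    refine ⟨⟨hac, ?_⟩, by simp [hcb.ne]⟩
    simpa [swap_apply_of_ne_of_ne hac.ne' hcb.ne] using h2
  have hfix : swapPair a b (a, c) = (a, c) := by
    simp [swapPair, swap_apply_of_ne_of_ne hac.ne' hcb.ne, hcb.le]
  have hmaps : Set.MapsTo (swapPair a b) (inversions w)
      ((inversions (w * swap a b) \ {(a, b)}) \ {(a, c)}) := by
    refine fun p hp => ⟨swapPair_mapsTo hab hw hp, fun he => ?_⟩
    have hpe : p = (a, c) := by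
      rw [← swapPair_swapPair (a := a) (b := b) hp.1, Set.mem_singleton_iff.mp he, hfix]
    rw [hpe] at hp
    exact absurd hp.2 (not_lt.mpr h1.le)
  have hfin : (inversions (w * swap a b) \ {(a, b)}).Finite :=
    (hf.mul (finSupp_swap a b)).finite_inversions.sdiff
  have hle : len w ≤ _ :=
    Set.ncard_le_ncard_of_injOn _ hmaps (swapPair_injOn w a b) hfin.sdiff
  have h3 := Set.ncard_sdiff_singleton_add_one hmem hfin
  have h4 := ncard_inversions_diff hf hab hw
  omega

/-- The criterion characterizing the `k`-Bruhat order: values at positions `≤ k` weakly increase,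
values at positions `> k` weakly decrease, and only pairs of positions on different sides of `k`
become inversions. -/
structure BruhatCriterion (k : ℕ+) (u w : Perm ℕ+) : Prop where
  le_of_le : ∀ i ≤ k, u i ≤ w i
  le_of_gt : ∀ i, k < i → w i ≤ u i
  cross : ∀ i j, i < j → u i < u j → w j < w i → i ≤ k ∧ k < j

theorem BruhatCriterion.of_kBruhat {k : ℕ+} {u w : Perm ℕ+} (hu : FinSupp u)
    (h : kBruhat k u w) : BruhatCriterion k u w := by
  suffices FinSupp w ∧ BruhatCriterion k u w from this.2
  induction h with
  | refl => exact ⟨hu, fun _ _ => le_rfl, fun _ _ => le_rfl,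
      fun i j _ h1 h2 => absurd h1 (not_lt.mpr h2.le)⟩
  | @tail w w' _ hc ih =>
    obtain ⟨hf, hI, hI', hII⟩ := ih
    obtain ⟨a, b, hak, hkb, rfl, hl⟩ := hc
    have hab := hak.trans_lt hkb
    obtain ⟨hw, hbet⟩ := lt_and_not_between_of_len_mul_swap hf hab hl
    refine ⟨hf.mul (finSupp_swap a b), fun i hi => ?_, fun i hi => ?_, fun i j hij h1 h2 => ?_⟩
    · have := hI i hi
      simp only [Perm.mul_apply, swap_apply_def]
      split_ifs <;> grind
    · have := hI' i hi
      simp only [Perm.mul_apply, swap_apply_def]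
      split_ifs <;> grind
    · have := hII i j hij h1
      have := hbet i
      have := hbet j
      have := w.injective.eq_iff (a := a) (b := j)
      have := w.injective.eq_iff (a := i) (b := b)
      simp only [Perm.mul_apply, swap_apply_def] at h2
      split_ifs at h2 <;> grind

/-- The choice of `α` and `β` made in one step of the algorithm. -/
structure IsAlgPair (ζ : Perm ℕ+) (α β : ℕ+) : Prop where
  lt_apply : α < ζ α
  le_of_lt_apply : ∀ x, x < ζ x → α ≤ x
  apply_lt : ζ β < ζ α
  apply_le : ζ α ≤ β
  le_of_apply : ∀ x, ζ x < ζ α → ζ α ≤ x → x ≤ β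

theorem apply_eq_of_forall_apply_le {ζ : Perm ℕ+} {α : ℕ+} (h : ∀ x < α, ζ x ≤ x) :
    ∀ x < α, ζ x = x := by
  intro x
  induction x using WellFoundedLT.induction with
  | ind x ih =>
    intro hx
    refine (h x hx).eq_or_lt.resolve_right fun hlt => ?_
    exact hlt.ne (ζ.injective (ih _ hlt (hlt.trans hx)))

theorem exists_isAlgPair {ζ : Perm ℕ+} (hζ : FinSupp ζ) (hne : ζ ≠ 1) :
    ∃ α β, IsAlgPair ζ α β := by
  have hex : {x | x < ζ x}.Nonempty := by
    by_contra! h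
    refine hne (Equiv.ext fun x => ?_)
    refine apply_eq_of_forall_apply_le (α := x + 1) (fun y _ => not_lt.mp fun hy => ?_) x
      (PNat.lt_add_right x 1)
    exact (h ▸ hy : y ∈ (∅ : Set ℕ+))
  obtain ⟨α, hα, hmin⟩ := WellFounded.has_min wellFounded_lt _ hex
  have hfin : {x | ζ x < ζ α ∧ ζ α ≤ x}.Finite :=
    hζ.subset fun x hx => (hx.1.trans_le hx.2).ne
  have hne' : {x | ζ x < ζ α ∧ ζ α ≤ x}.Nonempty := by
    by_contra! h
    have hmaps : Set.MapsTo ζ.symm (Set.Iio (ζ α)) (Set.Iio (ζ α)) := fun y hy => by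
      by_contra hy'
      have : ζ.symm y ∈ {x | ζ x < ζ α ∧ ζ α ≤ x} := ⟨by simpa using hy, not_lt.mp hy'⟩
      rw [h] at this
      exact this
    have himg : ζ.symm '' Set.Iio (ζ α) = Set.Iio (ζ α) :=
      Set.eq_of_subset_of_ncard_le hmaps.image_subset
        (Set.ncard_image_of_injective _ ζ.symm.injective).ge (Set.finite_Iio (ζ α))
    obtain ⟨y, hy, hyα⟩ := himg.symm ▸ (show α ∈ Set.Iio (ζ α) from hα)
    rw [Equiv.symm_apply_eq] at hyα
    exact hy.ne hyα
  obtain ⟨β, hβ, hmax⟩ := Set.exists_max_image _ id hfin hne'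
  exact ⟨α, β, hα, fun x hx => not_lt.mp (hmin x hx), hβ.1, hβ.2, fun x h1 h2 => hmax x ⟨h1, h2⟩⟩

namespace IsAlgPair

variable {ζ : Perm ℕ+} {α β : ℕ+}

theorem algStep (h : IsAlgPair ζ α β) : AlgStep ζ (ζ * swap α β) :=
  ⟨fun h1 => absurd h.lt_apply (by simp [h1]), α, β, ⟨h.lt_apply, h.le_of_lt_apply⟩,
    ⟨⟨h.apply_lt, h.apply_le⟩, h.le_of_apply⟩, rfl⟩

theorem lt (h : IsAlgPair ζ α β) : α < β := h.lt_apply.trans_le h.apply_le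

theorem apply_eq_of_lt (h : IsAlgPair ζ α β) : ∀ x < α, ζ x = x :=
  apply_eq_of_forall_apply_le fun x hx =>
    not_lt.mp fun hlt => absurd (h.le_of_lt_apply x hlt) (not_le.mpr hx)

theorem le_apply (h : IsAlgPair ζ α β) : α ≤ ζ β := by
  by_contra! hlt
  exact (hlt.trans h.lt).ne (ζ.injective (h.apply_eq_of_lt _ hlt))

theorem mul_swap_mul (u : Perm ℕ+) (a b : ℕ+) :
    ζ * swap (u a) (u b) * u = ζ * u * swap a b := by
  rw [mul_assoc, mul_assoc, Equiv.mul_swap_eq_swap_mul]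

theorem kBruhatCov_and_criterion (h : IsAlgPair ζ α β) (hζ : FinSupp ζ) {u : Perm ℕ+} {k : ℕ+}
    (hu : FinSupp u) (hc : BruhatCriterion k u (ζ * u)) :
    kBruhatCov k (ζ * swap α β * u) (ζ * u) ∧ BruhatCriterion k u (ζ * swap α β * u) := by
  obtain ⟨a, rfl⟩ := u.surjective α
  obtain ⟨b, rfl⟩ := u.surjective β
  have hfix : ∀ x, u x < u a → ζ (u x) = u x := fun x => h.apply_eq_of_lt (u x)
  have hmax : ∀ x, ζ (u x) < ζ (u a) → ζ (u a) ≤ u x → u x ≤ u b := fun x => h.le_of_apply (u x)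
  have hle := h.le_apply
  obtain ⟨hα, -, hβ, hβ', -⟩ := h
  obtain ⟨hI, hI', hII⟩ := hc
  simp only [Perm.mul_apply] at hI hI' hII
  have hak : a ≤ k := not_lt.mp fun hk => absurd hα (not_lt.mpr (hI' a hk))
  have hkb : k < b := not_le.mp fun hk => absurd (hβ.trans_le hβ') (not_lt.mpr (hI b hk))
  have hab := hak.trans_lt hkb
  have hinj : ∀ x y, u x = u y ↔ x = y := fun x y => u.injective.eq_iff
  rw [mul_swap_mul]
  constructor
  · refine ⟨a, b, hak, hkb, by simp [mul_assoc], ?_⟩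
    have hlen := len_mul_swap_eq_add_one (w := ζ * u * swap a b)
      ((hζ.mul hu).mul (finSupp_swap a b)) hab (by simpa using hβ) ?_
    · simpa [mul_assoc] using hlen
    intro c hac hcb h1 h2
    simp only [Perm.mul_apply, swap_apply_left, swap_apply_right,
      swap_apply_of_ne_of_ne hac.ne' hcb.ne] at h1 h2
    rcases le_or_gt c k with hck | hck
    · rcases lt_trichotomy (u a) (u c) with h3 | h3 | h3
      · exact absurd (hII a c hac h3 h2).2 (not_lt.mpr hck)
      · exact hac.ne ((hinj a c).mp h3)
      · exact absurd (hle.trans_lt h1) (not_lt.mpr ((hfix c h3).trans_lt h3).le)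
    · rcases lt_trichotomy (u c) (u b) with h3 | h3 | h3
      · exact absurd (hII c b hcb h3 h1).1 (not_le.mpr hck)
      · exact hcb.ne ((hinj c b).mp h3)
      · exact absurd (hmax c h2 (hβ'.trans h3.le)) (not_le.mpr h3)
  · refine ⟨fun i hi => ?_, fun i hi => ?_, fun i j hij h1 h2 => ?_⟩
    · have := hI i hi
      simp only [Perm.mul_apply, swap_apply_def]
      split_ifs <;> grind
    · have := hI' i hi
      simp only [Perm.mul_apply, swap_apply_def]
      split_ifs <;> grind
    · have := hII i j hij h1
      have := hfix i
      have := hmax j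
      simp only [Perm.mul_apply, swap_apply_def] at h2
      have : ζ (u i) = ζ (u j) → i = j := fun he => u.injective (ζ.injective he)
      split_ifs at h2 <;> grind

end IsAlgPair

theorem exists_algorithm_chain (n : ℕ) : ∀ ζ : Perm ℕ+, FinSupp ζ → len ζ = n →
    ∃ (m : ℕ) (c : ℕ → Perm ℕ+), c 0 = ζ ∧ c m = 1 ∧
      (∀ j < m, AlgStep (c j) (c (j + 1))) ∧
      ∀ (u : Perm ℕ+) (k : ℕ+), FinSupp u → BruhatCriterion k u (ζ * u) →
        (∀ j < m, kBruhatCov k (c (j + 1) * u) (c j * u)) ∧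
        len (ζ * u) = len u + m := by
  induction n using Nat.strong_induction_on with
  | _ n ih =>
    rintro ζ hζ rfl
    by_cases hne : ζ = 1
    · exact ⟨0, fun _ => 1, hne.symm, rfl, by simp, fun u k _ _ => by simp [hne]⟩
    obtain ⟨α, β, h⟩ := exists_isAlgPair hζ hne
    obtain ⟨m, c, hc0, hcm, hstep, hcov⟩ := ih _ (len_mul_swap_lt_len hζ h.lt h.apply_lt)
      (ζ * swap α β) (hζ.mul (finSupp_swap α β)) rfl
    refine ⟨m + 1, fun j => Nat.casesOn j ζ c, rfl, hcm, ?_, fun u k hu hcr => ?_⟩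
    · rintro (_ | j) hj
      · change AlgStep ζ (c 0)
        exact hc0 ▸ h.algStep
      · exact hstep j (by omega)
    · obtain ⟨hcov0, hcr'⟩ := h.kBruhatCov_and_criterion hζ hu hcr
      obtain ⟨hcovs, hlen⟩ := hcov u k hu hcr'
      refine ⟨?_, ?_⟩
      · rintro (_ | j) hj
        · change kBruhatCov k (c 0 * u) (ζ * u)
          exact hc0 ▸ hcov0
        · exact hcovs j (by omega)
      · obtain ⟨_, _, _, _, _, hl⟩ := hcov0
        omega

/-- The iteration `ζ = ζ_0, ζ_1, …` of the algorithm reaches the identity after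
finitely many steps `m`; and for every `u` and `k` with `u ≤_k ζu`, the sequence
`u = ζ_m u ⋖_k ζ_{m-1} u ⋖_k ⋯ ⋖_k ζ_0 u = ζu` is a saturated chain in the
`k`-Bruhat order; in particular `m = ℓ(ζu) - ℓ(u)`. -/
theorem stmt_3 (ζ : Equiv.Perm ℕ+) (hζ : FinSupp ζ) :
    ∃ (m : ℕ) (c : ℕ → Equiv.Perm ℕ+), c 0 = ζ ∧ c m = 1 ∧
      (∀ j < m, AlgStep (c j) (c (j + 1))) ∧
      ∀ (u : Equiv.Perm ℕ+) (k : ℕ+), FinSupp u → kBruhat k u (ζ * u) →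
        (∀ j < m, kBruhatCov k (c (j + 1) * u) (c j * u)) ∧
        len (ζ * u) = len u + m := by
  obtain ⟨m, c, h0, hm, hstep, hcov⟩ := exists_algorithm_chain _ ζ hζ rfl
  exact ⟨m, c, h0, hm, hstep, fun u k hu hk => hcov u k hu (.of_kBruhat hu hk)⟩
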